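/- There exists an absolute constant c > 0 with the following property. Let f be a centered stationary Gaussian process on ℤ with spectral measure μ, where μ is a finite nonzero symmetric Borel measure supported on [−1/2, 1/2], and suppose μ([−δ, δ]) = 0 for some δ ∈ (0, 1/2). Then for every integer L ≥ 0, the probability that f(0) ≥ 0, f(1) ≥ 0, …, f(L) ≥ 0 is at most exp(−c·δ²·L²). -/

import Mathlib

open MeasureTheory ProbabilityTheory Real
open scoped NNReal

section
open Polynomial

/-- `A` is the generating polynomial of a probability distribution on `{0, …, d}`. -/
structure IsProbabilityPolynomial (A : ℝ[X]) (d : ℕ) : Prop where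
  coeff_nonneg : ∀ k, 0 ≤ A.coeff k
  eval_one : A.eval 1 = 1
  natDegree_le : A.natDegree ≤ d

theorem IsProbabilityPolynomial.mul {A B : ℝ[X]} {d e : ℕ} (hA : IsProbabilityPolynomial A d)
    (hB : IsProbabilityPolynomial B e) : IsProbabilityPolynomial (A * B) (d + e) where
  coeff_nonneg k := by
    rw [coeff_mul]
    exact Finset.sum_nonneg fun p _ ↦ mul_nonneg (hA.coeff_nonneg _) (hB.coeff_nonneg _)
  eval_one := by rw [eval_mul, hA.eval_one, hB.eval_one, one_mul]
  natDegree_le := natDegree_mul_le.trans (add_le_add hA.natDegree_le hB.natDegree_le)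

theorem IsProbabilityPolynomial.of_nonneg {Q : ℝ[X]} {d : ℕ} (h : ∀ k, 0 ≤ Q.coeff k)
    (h1 : 0 < Q.eval 1) (hd : Q.natDegree ≤ d) :
    IsProbabilityPolynomial (C (Q.eval 1)⁻¹ * Q) d where
  coeff_nonneg k := by
    rw [coeff_C_mul]
    exact mul_nonneg (by positivity) (h k)
  eval_one := by rw [eval_mul, eval_C, inv_mul_cancel₀ h1.ne']
  natDegree_le := (natDegree_C_mul_le _ _).trans hd

theorem four_mul_le_norm_exp_sub_one {δ y : ℝ} (h1 : δ < |y|) (h2 : |y| ≤ 1 / 2) :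
    4 * δ ≤ ‖Complex.exp (2 * π * y * Complex.I) - 1‖ := by
  have e : (2 * π * y * Complex.I : ℂ) = Complex.I * ((2 * π * y : ℝ) : ℂ) := by
    push_cast; ring
  rw [e, Complex.norm_exp_I_mul_ofReal_sub_one, norm_mul, Real.norm_eq_abs, Real.norm_eq_abs]
  have hs : 2 * π * y / 2 = π * y := by ring
  have h3 := mul_le_sin (x := π * |y|) (by positivity) (by nlinarith [pi_pos])
  have h4 : |sin (π * y)| = sin (π * |y|) := by
    rcases abs_cases y with ⟨h, _⟩ | ⟨h, _⟩
    · rw [h, abs_of_nonneg (sin_nonneg_of_nonneg_of_le_pi (by positivity) (by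
        rw [h] at h2; nlinarith [pi_pos]))]
    · rw [← abs_neg, ← sin_neg, ← mul_neg, ← h, abs_of_nonneg]
      exact sin_nonneg_of_nonneg_of_le_pi (by positivity) (by nlinarith [pi_pos])
  rw [hs, h4, abs_two]
  have h5 : 2 / π * (π * |y|) = 2 * |y| := by field_simp
  linarith

theorem norm_sum_pow_mul {z u : ℂ} (hu : ‖u‖ = 1) (s : ℕ) :
    ‖∑ j ∈ Finset.range s, (z * u⁻¹) ^ j‖ * ‖z - u‖ = ‖z ^ s - u ^ s‖ := by
  have hu0 : u ≠ 0 := by rintro rfl; simp at hu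
  have h1 := geom_sum_mul (z * u⁻¹) s
  have h2 : z - u = (z * u⁻¹ - 1) * u := by field_simp
  have h3 : z ^ s - u ^ s = ((z * u⁻¹) ^ s - 1) * u ^ s := by
    rw [mul_pow, inv_pow]; field_simp
  rw [h2, h3, ← h1]
  simp [hu]

theorem aeval_cos_sum (φ : ℝ) (s : ℕ) (z : ℂ) :
    aeval z (∑ j ∈ Finset.range s, ∑ k ∈ Finset.range s,
      (C (cos ((j - k) * φ)) * X ^ (j + k) : ℝ[X])) =
    (∑ j ∈ Finset.range s, (z * (Complex.exp (φ * Complex.I))⁻¹) ^ j) *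
      ∑ k ∈ Finset.range s, (z * (Complex.exp (-φ * Complex.I))⁻¹) ^ k := by
  have key : (∑ j ∈ Finset.range s, (z * (Complex.exp (φ * Complex.I))⁻¹) ^ j) *
      (∑ k ∈ Finset.range s, (z * (Complex.exp (-φ * Complex.I))⁻¹) ^ k) =
      ∑ j ∈ Finset.range s, ∑ k ∈ Finset.range s,
        Complex.exp (-((j - k) * φ * Complex.I)) * z ^ (j + k) := by
    rw [Finset.sum_mul_sum]
    refine Finset.sum_congr rfl fun j _ ↦ Finset.sum_congr rfl fun k _ ↦ ?_
    rw [mul_pow, mul_pow, ← Complex.exp_neg, ← Complex.exp_neg, ← Complex.exp_nat_mul,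
      ← Complex.exp_nat_mul, mul_mul_mul_comm, ← Complex.exp_add, ← pow_add, mul_comm]
    congr 2; ring
  have key' : (∑ j ∈ Finset.range s, ∑ k ∈ Finset.range s,
        Complex.exp (-((j - k) * φ * Complex.I)) * z ^ (j + k)) =
      ∑ j ∈ Finset.range s, ∑ k ∈ Finset.range s,
        Complex.exp ((j - k) * φ * Complex.I) * z ^ (j + k) := by
    rw [Finset.sum_comm]
    refine Finset.sum_congr rfl fun j _ ↦ Finset.sum_congr rfl fun k _ ↦ ?_
    rw [add_comm k j]; congr 2; ring
  have h2 : (∑ j ∈ Finset.range s, ∑ k ∈ Finset.range s,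
        (Complex.cos ((j - k) * φ)) * z ^ (j + k)) =
      ((∑ j ∈ Finset.range s, ∑ k ∈ Finset.range s,
        Complex.exp ((j - k) * φ * Complex.I) * z ^ (j + k)) +
      ∑ j ∈ Finset.range s, ∑ k ∈ Finset.range s,
        Complex.exp (-((j - k) * φ * Complex.I)) * z ^ (j + k)) / 2 := by
    rw [← Finset.sum_add_distrib, Finset.sum_div]
    refine Finset.sum_congr rfl fun j _ ↦ ?_
    rw [← Finset.sum_add_distrib, Finset.sum_div]
    refine Finset.sum_congr rfl fun k _ ↦ ?_
    rw [Complex.cos]; ring_nf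
  rw [key, key']
  simp only [map_sum, map_mul, aeval_C, map_pow, aeval_X, Complex.coe_algebraMap,
    Complex.ofReal_cos]
  push_cast
  rw [h2, key']; ring

theorem div_two_le_sum_cos {φ : ℝ} {s : ℕ} (hs : 0 < s) (h : |φ| * s ≤ π / 2) :
    (s : ℝ) / 2 ≤ ∑ j ∈ Finset.range s, cos (j * φ) := by
  have hs' : (0 : ℝ) < s := by exact_mod_cast hs
  have h1 : ∀ j ∈ Finset.range s, 1 - (j : ℝ) / s ≤ cos (j * φ) := by
    intro j hj
    have hj' : (j : ℝ) ≤ s := by exact_mod_cast (Finset.mem_range.1 hj).le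
    have h2 : (j : ℝ) * |φ| ≤ π / 2 := by nlinarith [abs_nonneg φ]
    have := one_sub_mul_le_cos (x := j * |φ|) (by positivity) h2
    rw [← cos_abs, abs_mul, Nat.abs_cast]
    refine le_trans ?_ this
    have h3 : 2 / π * (j * |φ|) = j * (2 / π * |φ| ) := by ring
    have h4 : 2 / π * |φ| ≤ 1 / s := by
      rw [le_div_iff₀ hs', mul_assoc, div_mul_eq_mul_div, div_le_one pi_pos]; linarith
    rw [h3]
    have : (j : ℝ) * (2 / π * |φ|) ≤ j * (1 / s) := by gcongr
    rw [mul_one_div] at this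
    linarith
  refine le_trans ?_ (Finset.sum_le_sum h1)
  rw [Finset.sum_sub_distrib, ← Finset.sum_div]
  have h5 : (∑ j ∈ Finset.range s, (j : ℝ)) * 2 = s * (s - 1) := by
    have := Finset.sum_range_id_mul_two s
    have h6 : ((s - 1 : ℕ) : ℝ) = s - 1 := by rw [Nat.cast_sub hs]; simp
    rw [← h6, ← Nat.cast_sum]; exact_mod_cast this
  have h7 : (∑ j ∈ Finset.range s, (j : ℝ)) / s = (s - 1) / 2 := by
    rw [div_eq_div_iff hs'.ne' two_ne_zero, h5]; ring
  rw [h7]; simp; linarith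

theorem sq_le_sum_sum_cos {φ : ℝ} {s : ℕ} (hs : 0 < s) (h : |φ| * s ≤ π / 2) :
    (s : ℝ) ^ 2 / 4 ≤
      ∑ j ∈ Finset.range s, ∑ k ∈ Finset.range s, cos (((j : ℝ) - k) * φ) := by
  have e : ∑ j ∈ Finset.range s, ∑ k ∈ Finset.range s, cos (((j : ℝ) - k) * φ) =
      (∑ j ∈ Finset.range s, cos (j * φ)) ^ 2 + (∑ j ∈ Finset.range s, sin (j * φ)) ^ 2 := by
    simp_rw [sq, Finset.sum_mul_sum, ← Finset.sum_add_distrib]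
    refine Finset.sum_congr rfl fun j _ ↦ Finset.sum_congr rfl fun k _ ↦ ?_
    rw [sub_mul, cos_sub]
  rw [e]
  have := div_two_le_sum_cos hs h
  nlinarith [sq_nonneg (∑ j ∈ Finset.range s, sin (j * φ)), (Nat.cast_nonneg s : (0 : ℝ) ≤ s)]

theorem exists_isProbabilityPolynomial_of_cos_nonpos {θ : ℝ} (h : cos θ ≤ 0) (s : ℕ) :
    ∃ Q : ℝ[X], IsProbabilityPolynomial Q (2 * s) ∧ ∀ z : ℂ, ‖z‖ = 1 →
      ‖aeval z Q‖ ≤ 2 * ‖z ^ s - Complex.exp (θ * Complex.I)‖ := by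
  set Q : ℝ[X] := X ^ (2 * s) + C (-(2 * cos θ)) * X ^ s + 1 with hQ
  have h1 : Q.eval 1 = 2 - 2 * cos θ := by simp [hQ]; ring
  refine ⟨_, .of_nonneg (Q := Q) ?_ (by rw [h1]; linarith) ?_, fun z hz ↦ ?_⟩
  · intro k
    simp only [hQ, coeff_add, coeff_X_pow, coeff_C_mul, coeff_one]
    have : 0 ≤ -(2 * cos θ) := by linarith
    positivity
  · rw [hQ]; compute_degree!; omega
  · have h2 : aeval z Q =
        (z ^ s - Complex.exp (θ * Complex.I)) * (z ^ s - Complex.exp (-θ * Complex.I)) := by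
      have e1 : Complex.exp (θ * Complex.I) * Complex.exp (-θ * Complex.I) = 1 := by
        rw [← Complex.exp_add]; simp
      have e2 : 2 * Complex.cos θ =
          Complex.exp (θ * Complex.I) + Complex.exp (-θ * Complex.I) := by
        rw [Complex.cos]; ring
      simp only [hQ, map_add, map_pow, aeval_X, map_mul, aeval_C, map_neg, map_one,
        Complex.coe_algebraMap, Complex.ofReal_cos, Complex.ofReal_ofNat]
      rw [e2]; linear_combination e1.symm
    have h3 : ‖z ^ s - Complex.exp (-θ * Complex.I)‖ ≤ 2 := by
      refine (norm_sub_le _ _).trans ?_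
      have := Complex.norm_exp_ofReal_mul_I (-θ)
      push_cast at this
      rw [norm_pow, hz, this]; norm_num
    rw [map_mul, aeval_C, h2, h1, norm_mul, norm_mul, Complex.coe_algebraMap, Complex.norm_real,
      norm_inv, Real.norm_of_nonneg (by linarith)]
    have h4 : (2 - 2 * cos θ)⁻¹ ≤ 1 := inv_le_one_of_one_le₀ (by linarith)
    have h5 : 0 ≤ (2 - 2 * cos θ)⁻¹ := inv_nonneg.2 (by linarith)
    calc _ ≤ 1 * (‖z ^ s - Complex.exp (θ * Complex.I)‖ * 2) := by gcongr
      _ = _ := by ring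

theorem exists_isProbabilityPolynomial_of_abs_le {θ δ : ℝ} {s : ℕ} (hδ : 0 < δ) (hs : 1 ≤ δ * s)
    (hθ : |θ| ≤ π / 2) :
    ∃ Q : ℝ[X], IsProbabilityPolynomial Q (2 * s) ∧ ∀ z : ℂ, ‖z‖ = 1 → 4 * δ ≤ ‖z - 1‖ →
      ‖aeval z Q‖ ≤ 2 * ‖z ^ s - Complex.exp (θ * Complex.I)‖ := by
  have hs0 : 0 < s := Nat.pos_of_ne_zero fun h ↦ by norm_num [h] at hs
  have hs' : (0 : ℝ) < s := by exact_mod_cast hs0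
  set φ : ℝ := θ / s with hφ
  have hφs : |φ| * s = |θ| := by
    rw [hφ, abs_div, Nat.abs_cast, div_mul_cancel₀ _ hs'.ne']
  have hφδ : |φ| ≤ 2 * δ := by
    have h1 : |φ| * s ≤ 2 * δ * s := by rw [hφs]; nlinarith [pi_lt_four]
    exact le_of_mul_le_mul_right h1 hs'
  set Q : ℝ[X] := ∑ j ∈ Finset.range s, ∑ k ∈ Finset.range s,
      (C (cos ((j - k) * φ)) * X ^ (j + k) : ℝ[X]) with hQ
  have h1 : (s : ℝ) ^ 2 / 4 ≤ Q.eval 1 := by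
    refine (sq_le_sum_sum_cos hs0 (hφs.trans_le hθ)).trans_eq ?_
    simp [hQ, eval_finsetSum]
  have h1' : 0 < Q.eval 1 := lt_of_lt_of_le (by positivity) h1
  refine ⟨_, .of_nonneg (Q := Q) ?_ h1' ?_, fun z hz hz1 ↦ ?_⟩
  · intro i
    simp only [hQ, finsetSum_coeff, coeff_C_mul_X_pow]
    refine Finset.sum_nonneg fun j hj ↦ Finset.sum_nonneg fun k hk ↦ ?_
    have hj' : (j : ℝ) ≤ s := by exact_mod_cast (Finset.mem_range.1 hj).le
    have hk' : (k : ℝ) ≤ s := by exact_mod_cast (Finset.mem_range.1 hk).le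
    have h2 : |((j : ℝ) - k) * φ| ≤ π / 2 := by
      have : |(j : ℝ) - k| ≤ s := abs_le.2 ⟨by linarith [(Nat.cast_nonneg j : (0 : ℝ) ≤ j)],
        by linarith [(Nat.cast_nonneg k : (0 : ℝ) ≤ k)]⟩
      rw [abs_mul]
      nlinarith [abs_nonneg φ]
    split_ifs
    · exact cos_nonneg_of_mem_Icc ⟨(abs_le.1 h2).1, (abs_le.1 h2).2⟩
    · rfl
  · rw [hQ]
    refine natDegree_sum_le_of_forall_le _ _ fun j hj ↦
      natDegree_sum_le_of_forall_le _ _ fun k hk ↦ (natDegree_C_mul_X_pow_le _ _).trans ?_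
    have := Finset.mem_range.1 hj
    have := Finset.mem_range.1 hk
    omega
  · have hu (ψ : ℝ) (hψ : |ψ| ≤ 2 * δ) :
        ‖∑ j ∈ Finset.range s, (z * (Complex.exp (ψ * Complex.I))⁻¹) ^ j‖ ≤
          ‖z ^ s - Complex.exp ((s * ψ : ℝ) * Complex.I)‖ / (2 * δ) := by
      have h2 := norm_sum_pow_mul (z := z) (Complex.norm_exp_ofReal_mul_I ψ) s
      have h3 : ‖Complex.exp (ψ * Complex.I) - 1‖ ≤ 2 * δ := by
        rw [mul_comm]
        exact (Real.norm_exp_I_mul_ofReal_sub_one_le).trans hψ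
      have h4 : 2 * δ ≤ ‖z - Complex.exp (ψ * Complex.I)‖ := by
        have := norm_sub_le_norm_sub_add_norm_sub z (Complex.exp (ψ * Complex.I)) 1
        linarith
      rw [le_div_iff₀ (by positivity)]
      refine (mul_le_mul_of_nonneg_left h4 (norm_nonneg _)).trans ?_
      rw [h2, ← Complex.exp_nat_mul]
      push_cast
      rw [mul_assoc]
    have hsφ : s * φ = θ := by rw [hφ]; field_simp
    have h2 := hu φ hφδ
    have h3 := hu (-φ) (by rwa [abs_neg])
    rw [hsφ] at h2
    have h4 : ‖z ^ s - Complex.exp ((s * -φ : ℝ) * Complex.I)‖ ≤ 2 := by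
      refine (norm_sub_le _ _).trans ?_
      rw [norm_pow, hz, Complex.norm_exp_ofReal_mul_I]; norm_num
    have h5 : ‖aeval z Q‖ ≤ ‖z ^ s - Complex.exp (θ * Complex.I)‖ / (2 * δ) * (2 / (2 * δ)) := by
      rw [hQ, aeval_cos_sum, norm_mul]
      push_cast at h3 h4
      gcongr
      exact h3.trans (by gcongr)
    rw [map_mul, aeval_C, norm_mul, Complex.coe_algebraMap, Complex.norm_real, norm_inv,
      Real.norm_of_nonneg h1'.le]
    have h6 : (Q.eval 1)⁻¹ ≤ 4 * δ ^ 2 := by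
      rw [inv_le_comm₀ h1' (by positivity)]
      refine le_trans ?_ h1
      rw [inv_le_iff_one_le_mul₀ (by positivity)]
      nlinarith
    calc _ ≤ 4 * δ ^ 2 * (‖z ^ s - Complex.exp (θ * Complex.I)‖ / (2 * δ) * (2 / (2 * δ))) := by
          gcongr
      _ = _ := by field_simp; ring

theorem norm_sub_div_norm_le {w x : ℂ} (hx : ‖x‖ = 1) (hw : w ≠ 0) :
    ‖x - w / ‖w‖‖ ≤ 2 * ‖x - w‖ := by
  have h0 : (‖w‖ : ℂ) ≠ 0 := by simpa using hw
  have h1 : x - w / ‖w‖ = (x - w) + w / ‖w‖ * ((‖w‖ - ‖x‖ : ℝ) : ℂ) := by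
    rw [hx]; push_cast; field_simp; ring
  have h2 : ‖w / ‖w‖‖ = 1 := by
    rw [norm_div, Complex.norm_real, norm_norm, div_self (norm_ne_zero_iff.2 hw)]
  rw [h1]
  refine (norm_add_le _ _).trans ?_
  rw [norm_mul, h2, one_mul, Complex.norm_real, Real.norm_eq_abs, abs_sub_comm]
  linarith [abs_norm_sub_norm_le x w]

theorem exists_isProbabilityPolynomial_norm_le {δ : ℝ} {s : ℕ} (hδ : 0 < δ) (hs : 1 ≤ δ * s)
    (w : ℂ) :
    ∃ Q : ℝ[X], IsProbabilityPolynomial Q (2 * s) ∧ ∀ z : ℂ, ‖z‖ = 1 → 4 * δ ≤ ‖z - 1‖ →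
      ‖aeval z Q‖ ≤ 4 * ‖z ^ s - w‖ := by
  obtain ⟨Q, hQ, hQz⟩ : ∃ Q : ℝ[X], IsProbabilityPolynomial Q (2 * s) ∧
      ∀ z : ℂ, ‖z‖ = 1 → 4 * δ ≤ ‖z - 1‖ →
        ‖aeval z Q‖ ≤ 2 * ‖z ^ s - Complex.exp (w.arg * Complex.I)‖ := by
    rcases le_total (cos w.arg) 0 with h | h
    · obtain ⟨Q, hQ, hQz⟩ := exists_isProbabilityPolynomial_of_cos_nonpos h s
      exact ⟨Q, hQ, fun z hz _ ↦ hQz z hz⟩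
    · refine exists_isProbabilityPolynomial_of_abs_le hδ hs (le_of_not_gt fun h' ↦ ?_)
      have := cos_neg_of_pi_div_two_lt_of_lt (x := |w.arg|) h'
        (by linarith [Complex.abs_arg_le_pi w, pi_pos])
      rw [cos_abs] at this
      linarith
  refine ⟨Q, hQ, fun z hz hz1 ↦ (hQz z hz hz1).trans ?_⟩
  have hzs : ‖z ^ s‖ = 1 := by rw [norm_pow, hz, one_pow]
  suffices ‖z ^ s - Complex.exp (w.arg * Complex.I)‖ ≤ 2 * ‖z ^ s - w‖ by linarith
  rcases eq_or_ne w 0 with rfl | hw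
  · refine (norm_sub_le _ _).trans ?_
    rw [Complex.norm_exp_ofReal_mul_I, sub_zero, hzs]; norm_num
  · have h0 : (‖w‖ : ℂ) ≠ 0 := by simpa using hw
    have : Complex.exp (w.arg * Complex.I) = w / ‖w‖ := by
      rw [eq_div_iff h0, mul_comm, Complex.norm_mul_exp_arg_mul_I]
    rw [this]
    exact norm_sub_div_norm_le hzs hw

theorem exists_isProbabilityPolynomial_norm_le_div {δ : ℝ} (hδ : 0 < δ) {m : ℕ} (hm : 0 < m) :
    ∃ K : ℝ[X], IsProbabilityPolynomial K m ∧ ∀ z : ℂ, ‖z‖ = 1 → 4 * δ ≤ ‖z - 1‖ →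
      ‖aeval z K‖ ≤ 1 / (2 * (δ * m)) := by
  set Q : ℝ[X] := ∑ k ∈ Finset.range m, X ^ k with hQ
  have hm' : (0 : ℝ) < m := by exact_mod_cast hm
  have h1 : Q.eval 1 = m := by simp [hQ, eval_finsetSum]
  refine ⟨_, .of_nonneg (Q := Q) ?_ (by rwa [h1]) ?_, fun z hz hz1 ↦ ?_⟩
  · intro i
    simp only [hQ, finsetSum_coeff, coeff_X_pow]
    exact Finset.sum_nonneg fun j _ ↦ by positivity
  · rw [hQ]
    refine natDegree_sum_le_of_forall_le _ _ fun j hj ↦ (natDegree_X_pow_le _).trans ?_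
    exact (Finset.mem_range.1 hj).le
  · have h2 : aeval z Q * (z - 1) = z ^ m - 1 := by
      rw [← geom_sum_mul]; simp [hQ]
    have h3 : ‖aeval z Q‖ * (4 * δ) ≤ 2 := by
      refine (mul_le_mul_of_nonneg_left hz1 (norm_nonneg _)).trans ?_
      rw [← norm_mul, h2]
      refine (norm_sub_le _ _).trans ?_
      rw [norm_pow, hz]; norm_num
    rw [map_mul, aeval_C, norm_mul, Complex.coe_algebraMap, Complex.norm_real, norm_inv, h1,
      Real.norm_of_nonneg hm'.le, inv_mul_le_iff₀ hm']
    have : (m : ℝ) * (1 / (2 * (δ * m))) = 2 / (4 * δ) := by field_simp; norm_num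
    rw [this, le_div_iff₀ (by positivity)]
    exact h3

theorem exists_isProbabilityPolynomial_multiset {δ : ℝ} {s M : ℕ} (hδ : 0 < δ) (hs : 1 ≤ δ * s)
    (hM : 0 < M) (S : Multiset ℂ) :
    ∃ A : ℝ[X], IsProbabilityPolynomial A (S.card * (2 * (1 + M)) * s) ∧
      ∀ z : ℂ, ‖z‖ = 1 → 4 * δ ≤ ‖z - 1‖ →
        ‖aeval z A‖ ≤ (1 / (M : ℝ) ^ 2) ^ S.card * ‖(S.map fun w ↦ z ^ s - w).prod‖ := by
  have hs0 : 0 < s := Nat.pos_of_ne_zero fun h ↦ by norm_num [h] at hs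
  obtain ⟨K, hK, hKz⟩ := exists_isProbabilityPolynomial_norm_le_div hδ (Nat.mul_pos hM hs0)
  induction S using Multiset.induction with
  | empty => exact ⟨1, ⟨fun k ↦ by rw [coeff_one]; positivity, by simp, by simp⟩, by simp⟩
  | cons w S ih =>
    obtain ⟨A, hA, hAz⟩ := ih
    obtain ⟨Q, hQ, hQz⟩ := exists_isProbabilityPolynomial_norm_le hδ hs w
    refine ⟨Q * (K * K) * A, ?_, fun z hz hz1 ↦ ?_⟩
    · convert (hQ.mul (hK.mul hK)).mul hA using 1
      rw [Multiset.card_cons]; ring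
    · rw [map_mul, map_mul, map_mul, norm_mul, norm_mul, norm_mul, Multiset.map_cons,
        Multiset.prod_cons, norm_mul, Multiset.card_cons]
      have hM' : (0 : ℝ) < M := by exact_mod_cast hM
      have h1 : ‖aeval z K‖ ≤ 1 / (2 * M) := by
        refine (hKz z hz hz1).trans ?_
        push_cast
        gcongr
        nlinarith
      calc _ ≤ 4 * ‖z ^ s - w‖ * (1 / (2 * M) * (1 / (2 * M))) *
            ((1 / (M : ℝ) ^ 2) ^ S.card * ‖(S.map fun w ↦ z ^ s - w).prod‖) := by
            gcongr
            exacts [hQz z hz hz1, hAz z hz hz1]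
        _ = 4 * (1 / (2 * M) * (1 / (2 * M))) * (1 / (M : ℝ) ^ 2) ^ S.card *
            (‖z ^ s - w‖ * ‖(S.map fun w ↦ z ^ s - w).prod‖) := by ring
        _ = _ := by
            have : 4 * (1 / (2 * M) * (1 / (2 * M))) = 1 / (M : ℝ) ^ 2 := by
              field_simp; norm_num
            rw [this, pow_succ' (1 / (M : ℝ) ^ 2)]

theorem Polynomial.Monic.exists_isProbabilityPolynomial {p : ℝ[X]} (hp : p.Monic) {δ : ℝ}
    {s M : ℕ} (hδ : 0 < δ) (hs : 1 ≤ δ * s) (hM : 0 < M) :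
    ∃ A : ℝ[X], IsProbabilityPolynomial A (p.natDegree * (2 * (1 + M)) * s) ∧
      ∀ z : ℂ, ‖z‖ = 1 → 4 * δ ≤ ‖z - 1‖ →
        ‖aeval z A‖ ≤ (1 / (M : ℝ) ^ 2) ^ p.natDegree * ‖aeval (z ^ s) p‖ := by
  obtain ⟨A, hA, hAz⟩ := exists_isProbabilityPolynomial_multiset hδ hs hM
    (p.map (algebraMap ℝ ℂ)).roots
  have hsp := IsAlgClosed.splits (p.map (algebraMap ℝ ℂ))
  have hd : (p.map (algebraMap ℝ ℂ)).roots.card = p.natDegree := by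
    rw [← hsp.natDegree_eq_card_roots, hp.natDegree_map]
  rw [hd] at hA hAz
  refine ⟨A, hA, fun z hz hz1 ↦ (hAz z hz hz1).trans_eq ?_⟩
  have h1 : aeval (z ^ s) p = (((p.map (algebraMap ℝ ℂ)).roots).map fun w ↦ z ^ s - w).prod := by
    rw [aeval_def, ← eval_map]
    conv_lhs => rw [hsp.eq_prod_roots_of_monic (hp.map _)]
    rw [eval_multiset_prod, Multiset.map_map]
    simp
  rw [h1]
end

theorem gaussianReal_Icc_le {v : ℝ≥0} (hv : v ≠ 0) (a b : ℝ) :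
    gaussianReal 0 v (Set.Icc a b) ≤ ENNReal.ofReal ((b - a) / √v) := by
  have hv' : (0 : ℝ) < v := by positivity
  rw [gaussianReal_apply 0 hv]
  calc ∫⁻ x in Set.Icc a b, gaussianPDF 0 v x
      ≤ ∫⁻ _ in Set.Icc a b, ENNReal.ofReal (1 / √v) := by
        refine lintegral_mono fun x ↦ ENNReal.ofReal_le_ofReal ?_
        rw [gaussianPDFReal, ← one_div]
        have h1 : rexp (-(x - 0) ^ 2 / (2 * v)) ≤ 1 := by
          rw [exp_le_one_iff]
          exact div_nonpos_of_nonpos_of_nonneg (neg_nonpos.2 (sq_nonneg _)) (by positivity)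
        have h2 : √v ≤ √(2 * π * v) := Real.sqrt_le_sqrt (by nlinarith [pi_gt_three])
        calc 1 / √(2 * π * v) * rexp (-(x - 0) ^ 2 / (2 * v)) ≤ 1 / √(2 * π * v) * 1 := by gcongr
          _ ≤ 1 / √v := by rw [mul_one]; gcongr
    _ = ENNReal.ofReal ((b - a) / √v) := by
        rw [setLIntegral_const, Real.volume_Icc, ← ENNReal.ofReal_mul (by positivity)]
        congr 1; ring

theorem measure_le_of_indepFun {Ω α β : Type*} {_ : MeasurableSpace Ω} {_ : MeasurableSpace α}
    {_ : MeasurableSpace β} {P : Measure Ω} [IsProbabilityMeasure P] {W : Ω → α} {Z : Ω → β}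
    (h : IndepFun W Z P) (hW : AEMeasurable W P) (hZ : AEMeasurable Z P) {A : Set α}
    (hA : MeasurableSet A) {B : Set (α × β)} (hB : MeasurableSet B) {b : ENNReal}
    (hb : ∀ w, P.map Z (Prod.mk w ⁻¹' B) ≤ b) :
    P {ω | W ω ∈ A ∧ (W ω, Z ω) ∈ B} ≤ b * P {ω | W ω ∈ A} := by
  have := Measure.isProbabilityMeasure_map (μ := P) hZ
  have hC : MeasurableSet ((A ×ˢ Set.univ) ∩ B) := (hA.prod .univ).inter hB
  have e1 : {ω | W ω ∈ A ∧ (W ω, Z ω) ∈ B} = (fun ω ↦ (W ω, Z ω)) ⁻¹' ((A ×ˢ Set.univ) ∩ B) := by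
    ext ω; simp
  rw [e1, ← Measure.map_apply_of_aemeasurable (hW.prodMk hZ) hC,
    (indepFun_iff_map_prod_eq_prod_map_map hW hZ).1 h, Measure.prod_apply hC]
  calc ∫⁻ w, P.map Z (Prod.mk w ⁻¹' ((A ×ˢ Set.univ) ∩ B)) ∂(P.map W)
      ≤ ∫⁻ w, A.indicator (fun _ ↦ b) w ∂(P.map W) := by
        refine lintegral_mono fun w ↦ ?_
        by_cases hw : w ∈ A
        · rw [Set.indicator_of_mem hw]
          exact (measure_mono fun z hz ↦ hz.2).trans (hb w)
        · have : Prod.mk w ⁻¹' ((A ×ˢ Set.univ) ∩ B) = ∅ := by ext z; simp [hw]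
          simp [this]
    _ = b * P {ω | W ω ∈ A} := by
        rw [lintegral_indicator_const hA, Measure.map_apply_of_aemeasurable hW hA]; rfl

theorem exists_forall_inner_sub_sum_eq_zero {E : Type*} [NormedAddCommGroup E]
    [InnerProductSpace ℝ E] (y : ℕ → E) (k : ℕ) :
    ∃ c : ℕ → ℝ, ∀ j < k, inner ℝ (y k - ∑ i ∈ Finset.range k, c i • y i) (y j) = 0 := by
  let K := Submodule.span ℝ (Set.range fun i : Fin k ↦ y i)
  have hK : FiniteDimensional ℝ K := FiniteDimensional.span_of_finite ℝ (Set.finite_range _)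
  obtain ⟨c, hc⟩ := (Submodule.mem_span_range_iff_exists_fun ℝ).1
    (K.starProjection_apply_mem (y k))
  refine ⟨fun i ↦ if h : i < k then c ⟨i, h⟩ else 0, fun j hj ↦ ?_⟩
  have : ∑ i ∈ Finset.range k, (if h : i < k then c ⟨i, h⟩ else 0) • y i
      = K.starProjection (y k) := by
    rw [← hc, Finset.sum_range]; simp
  rw [this]
  exact Submodule.starProjection_inner_eq_zero _ _ (Submodule.subset_span ⟨⟨j, hj⟩, rfl⟩)

theorem coeFn_sum_smul_toLp {Ω ι : Type*} {_ : MeasurableSpace Ω} {P : Measure Ω}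
    {Y : ι → Ω → ℝ} (hY : ∀ i, MemLp (Y i) 2 P) (c : ι → ℝ) (s : Finset ι) :
    (∑ i ∈ s, c i • (hY i).toLp : Lp ℝ 2 P) =ᵐ[P] fun ω ↦ ∑ i ∈ s, c i * Y i ω := by
  classical
  induction s using Finset.induction_on with
  | empty =>
    simp only [Finset.sum_empty]
    exact Lp.coeFn_zero ℝ 2 P
  | insert a s ha ih =>
    rw [Finset.sum_insert ha]
    filter_upwards [ih, (hY a).coeFn_toLp, Lp.coeFn_smul (c a) (hY a).toLp,
      Lp.coeFn_add (c a • (hY a).toLp) (∑ i ∈ s, c i • (hY i).toLp)] with ω h1 h2 h3 h4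
    rw [h4, Pi.add_apply, h1, h3, Pi.smul_apply, h2, Finset.sum_insert ha, smul_eq_mul]

theorem exists_forall_integral_sub_sum_mul_eq_zero {Ω : Type*} {_ : MeasurableSpace Ω}
    {P : Measure Ω} {Y : ℕ → Ω → ℝ} (hY : ∀ i, MemLp (Y i) 2 P) (k : ℕ) :
    ∃ c : ℕ → ℝ, ∀ j < k,
      ∫ ω, (Y k ω - ∑ i ∈ Finset.range k, c i * Y i ω) * Y j ω ∂P = 0 := by
  obtain ⟨c, hc⟩ := exists_forall_inner_sub_sum_eq_zero (fun i ↦ (hY i).toLp) k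
  refine ⟨c, fun j hj ↦ ?_⟩
  rw [← hc j hj, L2.inner_def]
  refine integral_congr_ae ?_
  filter_upwards [coeFn_sum_smul_toLp hY c (Finset.range k), (hY j).coeFn_toLp,
    (hY k).coeFn_toLp, Lp.coeFn_sub (hY k).toLp (∑ i ∈ Finset.range k, c i • (hY i).toLp)]
    with ω h1 h2 h3 h4
  rw [h2, h4, Pi.sub_apply, h1, h3]
  simp [mul_comm]

theorem isGaussianProcess_of_forall_map_sum {Ω T : Type*} {_ : MeasurableSpace Ω} {P : Measure Ω}
    {f : T → Ω → ℝ}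
    (h : ∀ (m : ℕ) (x : Fin m → T) (a : Fin m → ℝ), ∃ v : ℝ≥0,
      P.map (fun ω => ∑ i, a i * f (x i) ω) = gaussianReal 0 v) :
    IsGaussianProcess f P := by
  classical
  have hf (t : T) : AEMeasurable (f t) P := by
    obtain ⟨v, hv⟩ := h 1 (fun _ ↦ t) (fun _ ↦ 1)
    simp only [Finset.univ_unique, Finset.sum_singleton, one_mul] at hv
    refine AEMeasurable.of_map_ne_zero ?_
    rw [hv]
    exact IsProbabilityMeasure.ne_zero _
  refine ⟨fun I ↦ ⟨isGaussian_of_map_eq_gaussianReal fun L ↦ ?_⟩⟩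
  obtain ⟨v, hv⟩ := h I.card (fun i ↦ I.equivFin.symm i)
    (fun i ↦ L (Pi.single (I.equivFin.symm i) 1))
  refine ⟨0, v, ?_⟩
  have hI : AEMeasurable (fun ω ↦ I.restrict (f · ω)) P :=
    aemeasurable_pi_lambda _ fun t : I ↦ hf t
  rw [AEMeasurable.map_map_of_aemeasurable (by fun_prop) hI, ← hv]
  congr 1
  ext ω
  rw [Function.comp_apply, Equiv.sum_comp I.equivFin.symm (fun t ↦ L (Pi.single t 1) * f t ω)]
  conv_lhs => rw [← Finset.univ_sum_single (I.restrict (f · ω)), map_sum]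
  refine Finset.sum_congr rfl fun t _ ↦ ?_
  rw [mul_comm, ← smul_eq_mul, ← map_smul, ← Pi.single_smul, smul_eq_mul, mul_one]
  rfl

theorem integral_eq_zero_of_forall_map_sum {Ω T : Type*} {_ : MeasurableSpace Ω} {P : Measure Ω}
    {f : T → Ω → ℝ}
    (h : ∀ (m : ℕ) (x : Fin m → T) (a : Fin m → ℝ), ∃ v : ℝ≥0,
      P.map (fun ω => ∑ i, a i * f (x i) ω) = gaussianReal 0 v) (t : T) :
    ∫ ω, f t ω ∂P = 0 := by
  obtain ⟨v, hv⟩ := h 1 (fun _ ↦ t) (fun _ ↦ 1)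
  simp only [Finset.univ_unique, Finset.sum_singleton, one_mul] at hv
  have := integral_map ((isGaussianProcess_of_forall_map_sum h).aemeasurable t)
    (f := fun x : ℝ ↦ x) (by fun_prop)
  rw [← this]
  erw [hv]
  exact integral_id_gaussianReal

theorem map_eq_gaussianReal_integral_sq {Ω : Type*} {_ : MeasurableSpace Ω} {P : Measure Ω}
    {X : Ω → ℝ} (h : HasGaussianLaw X P) (h0 : ∫ ω, X ω ∂P = 0) :
    P.map X = gaussianReal 0 (∫ ω, X ω ^ 2 ∂P).toNNReal := by
  rw [h.map_eq_gaussianReal, variance_of_integral_eq_zero h.aemeasurable h0, h0]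

theorem hasGaussianLaw_sum_mul {Ω T : Type*} {_ : MeasurableSpace Ω} {P : Measure Ω}
    {Y : T → Ω → ℝ} (hY : IsGaussianProcess Y P) (c : T → ℝ) (s : Finset T) :
    HasGaussianLaw (fun ω ↦ ∑ i ∈ s, c i * Y i ω) P := by
  exact (hY.smul c).hasGaussianLaw_fun_sum

theorem measure_forall_abs_le_le {Ω : Type*} {_ : MeasurableSpace Ω} {P : Measure Ω}
    {Y : ℕ → Ω → ℝ} (hY : IsGaussianProcess Y P) (h0 : ∀ i, ∫ ω, Y i ω ∂P = 0)
    {σ ε : ℝ} (hσ : 0 < σ) (hε : 0 ≤ ε) (n : ℕ)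
    (h : ∀ k < n, ∀ c : ℕ → ℝ,
      σ ^ 2 ≤ ∫ ω, (Y k ω - ∑ i ∈ Finset.range k, c i * Y i ω) ^ 2 ∂P) :
    P {ω | ∀ i < n, |Y i ω| ≤ ε} ≤ ENNReal.ofReal (2 * ε / σ) ^ n := by
  have := hY.isProbabilityMeasure
  have hL (i : ℕ) : MemLp (Y i) 2 P := (hY.hasGaussianLaw_eval i).memLp_two
  induction n with
  | zero => simp
  | succ k ih =>
    obtain ⟨c, hc⟩ := exists_forall_integral_sub_sum_mul_eq_zero hL k
    set Z : Ω → ℝ := fun ω ↦ Y k ω - ∑ i ∈ Finset.range k, c i * Y i ω with hZdef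
    have hjoint : IsGaussianProcess
        (Sum.elim (fun i : Fin k ↦ Y i) (fun _ : Unit ↦ Z)) P := by
      refine hY.of_isGaussianProcess fun t ↦ ⟨Finset.range (k + 1), ?_⟩
      rcases t with i | _
      · exact ⟨.proj ⟨i, by simp⟩, fun ω ↦ rfl⟩
      · refine ⟨.proj ⟨k, by simp⟩ - ∑ i : Fin k, c i • .proj ⟨i, by simp⟩,
          fun ω ↦ ?_⟩
        simp [hZdef, Finset.sum_range]
    have hZm : AEMeasurable Z P := hjoint.aemeasurable (.inr ())
    have hZG : HasGaussianLaw Z P := hjoint.hasGaussianLaw_eval (.inr ())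
    have hZ0 : ∫ ω, Z ω ∂P = 0 := by
      have hI (i : ℕ) : Integrable (Y i) P := (hY.hasGaussianLaw_eval i).integrable
      rw [hZdef, integral_sub (hI k) (integrable_finsetSum _ fun i _ ↦ (hI i).const_mul _),
        integral_finsetSum _ fun i _ ↦ (hI i).const_mul _]
      simp [integral_const_mul, h0]
    have hind : IndepFun (fun ω (i : Fin k) ↦ Y i ω) Z P := by
      have h1 := hjoint.indepFun_of_covariance_eq_zero (fun i ↦ hY.aemeasurable i)
        (fun _ ↦ hZm) (fun i _ ↦ by
          rw [covariance_comm, covariance_eq_sub hZG.memLp_two (hL i), hZ0, zero_mul, sub_zero]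
          exact hc i i.2)
      exact h1.comp (φ := id) (ψ := fun z : Unit → ℝ ↦ z ()) measurable_id (measurable_pi_apply ())
    have hW : AEMeasurable (fun ω (i : Fin k) ↦ Y i ω) P :=
      aemeasurable_pi_lambda _ fun i ↦ hY.aemeasurable i
    have hv := h k (Nat.lt_succ_self k) c
    have hvpos : 0 < ∫ ω, Z ω ^ 2 ∂P := lt_of_lt_of_le (by positivity) hv
    have hA : MeasurableSet {w : Fin k → ℝ | ∀ i, |w i| ≤ ε} := by
      rw [Set.ofPred_forall]
      exact .iInter fun i ↦ measurableSet_le (by fun_prop) measurable_const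
    have hB : MeasurableSet {p : (Fin k → ℝ) × ℝ | |p.2 + ∑ i : Fin k, c i * p.1 i| ≤ ε} :=
      measurableSet_le (by fun_prop) measurable_const
    have key := measure_le_of_indepFun hind hW hZm hA hB (b := ENNReal.ofReal (2 * ε / σ)) (by
      intro w
      rw [map_eq_gaussianReal_integral_sq hZG hZ0]
      have e : Prod.mk w ⁻¹' {p : (Fin k → ℝ) × ℝ | |p.2 + ∑ i : Fin k, c i * p.1 i| ≤ ε} =
          Set.Icc (-ε - ∑ i : Fin k, c i * w i) (ε - ∑ i : Fin k, c i * w i) := by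
        ext z
        simp only [Set.mem_preimage, Set.mem_ofPred_eq, abs_le, Set.mem_Icc]
        constructor <;> rintro ⟨h1, h2⟩ <;> constructor <;> linarith
      rw [e]
      refine (gaussianReal_Icc_le (by simpa using hvpos) _ _).trans (ENNReal.ofReal_le_ofReal ?_)
      rw [Real.coe_toNNReal _ hvpos.le]
      have : σ ≤ √(∫ ω, Z ω ^ 2 ∂P) := Real.le_sqrt_of_sq_le hv
      have e2 : ε - ∑ i : Fin k, c i * w i - (-ε - ∑ i : Fin k, c i * w i) = 2 * ε := by ring
      rw [e2]
      gcongr)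
    have e1 : {ω | ∀ i < k + 1, |Y i ω| ≤ ε} =
        {ω | (fun i : Fin k ↦ Y i ω) ∈ {w : Fin k → ℝ | ∀ i, |w i| ≤ ε} ∧
          ((fun i : Fin k ↦ Y i ω), Z ω) ∈
            {p : (Fin k → ℝ) × ℝ | |p.2 + ∑ i : Fin k, c i * p.1 i| ≤ ε}} := by
      ext ω
      simp only [Set.mem_ofPred_eq, Nat.forall_lt_succ_right, hZdef, Finset.sum_range,
        sub_add_cancel, Fin.forall_iff]
    have e2 : {ω | (fun i : Fin k ↦ Y i ω) ∈ {w : Fin k → ℝ | ∀ i, |w i| ≤ ε}} =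
        {ω | ∀ i < k, |Y i ω| ≤ ε} := by
      ext ω
      simp [Fin.forall_iff]
    rw [e1, pow_succ']
    refine key.trans ?_
    rw [e2]
    gcongr
    exact ih fun j hj ↦ h j (by omega)

section
open Polynomial

theorem exists_weights_norm_le {δ : ℝ} {s M : ℕ} (hδ : 0 < δ) (hs : 1 ≤ δ * s) (hM : 0 < M)
    (n : ℕ) (c : ℕ → ℝ) :
    ∃ a : ℕ → ℝ, (∀ k, 0 ≤ a k) ∧
      ∑ k ∈ Finset.range (s * (n * (2 * (1 + M)) + 1)), a k = 1 ∧
      ∀ z : ℂ, ‖z‖ = 1 → 4 * δ ≤ ‖z - 1‖ →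
        ‖∑ k ∈ Finset.range (s * (n * (2 * (1 + M)) + 1)), (a k : ℂ) * z ^ k‖ ≤
          (1 / (M : ℝ) ^ 2) ^ n * ‖(z ^ s) ^ n - ∑ i ∈ Finset.range n, (c i : ℂ) * (z ^ s) ^ i‖ := by
  have hs0 : 0 < s := Nat.pos_of_ne_zero fun h ↦ by norm_num [h] at hs
  have hdeg : (∑ i ∈ Finset.range n, C (c i) * X ^ i : ℝ[X]).degree < n := by
    refine (degree_sum_le _ _).trans_lt ((Finset.sup_lt_iff (WithBot.bot_lt_coe n)).2 fun i hi ↦ ?_)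
    exact (degree_C_mul_X_pow_le _ _).trans_lt (Nat.cast_lt.2 (Finset.mem_range.1 hi))
  have hp : (X ^ n - ∑ i ∈ Finset.range n, C (c i) * X ^ i : ℝ[X]).Monic := monic_X_pow_sub hdeg
  have hd : (X ^ n - ∑ i ∈ Finset.range n, C (c i) * X ^ i : ℝ[X]).natDegree = n := by
    refine natDegree_eq_of_degree_eq_some ?_
    rw [degree_sub_eq_left_of_degree_lt (by rwa [degree_X_pow]), degree_X_pow]
  obtain ⟨A, hA, hAz⟩ := hp.exists_isProbabilityPolynomial hδ hs hM
  rw [hd] at hA hAz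
  have hlt : A.natDegree < s * (n * (2 * (1 + M)) + 1) := by
    refine hA.natDegree_le.trans_lt ?_
    rw [mul_comm]
    exact Nat.mul_lt_mul_of_pos_left (Nat.lt_succ_self _) hs0
  refine ⟨A.coeff, hA.coeff_nonneg, ?_, fun z hz hz1 ↦ ?_⟩
  · simpa [eval_eq_sum_range' hlt] using hA.eval_one
  · simpa [aeval_eq_sum_range' hlt] using hAz z hz hz1

end

theorem sum_range_mul_eq (g : ℕ → ℝ) (s U : ℕ) :
    ∑ k ∈ Finset.range (s * U), g k =
      ∑ u ∈ Finset.range U, ∑ r ∈ Finset.range s, g (s * u + r) := by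
  induction U with
  | zero => simp
  | succ U ih => rw [mul_add, mul_one, Finset.sum_range_add, Finset.sum_range_succ, ih]

theorem norm_sum_mul_exp_sq {ι : Type*} (S : Finset ι) (c x : ι → ℝ) :
    ‖∑ i ∈ S, (c i : ℂ) * Complex.exp (x i * Complex.I)‖ ^ 2 =
      ∑ i ∈ S, ∑ j ∈ S, c i * c j * cos (x i - x j) := by
  have h : ∑ i ∈ S, (c i : ℂ) * Complex.exp (x i * Complex.I) =
      ((∑ i ∈ S, c i * cos (x i) : ℝ) : ℂ) + ((∑ i ∈ S, c i * sin (x i) : ℝ) : ℂ) * Complex.I := by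
    push_cast
    rw [Finset.sum_mul, ← Finset.sum_add_distrib]
    refine Finset.sum_congr rfl fun i _ ↦ ?_
    rw [Complex.exp_mul_I]; ring
  rw [h, ← Complex.normSq_eq_norm_sq, Complex.normSq_add_mul_I, sq, sq, Finset.sum_mul_sum,
    Finset.sum_mul_sum, ← Finset.sum_add_distrib]
  refine Finset.sum_congr rfl fun i _ ↦ ?_
  rw [← Finset.sum_add_distrib]
  refine Finset.sum_congr rfl fun j _ ↦ ?_
  rw [cos_sub]; ring

theorem integral_sq_sum_eq {Ω ι : Type*} {_ : MeasurableSpace Ω} {P : Measure Ω}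
    {μ : Measure ℝ} [IsFiniteMeasure μ] {f : ℤ → Ω → ℝ} (hf : IsGaussianProcess f P)
    (hcov : ∀ j k : ℤ, ∫ ω, f j ω * f k ω ∂P = ∫ y, cos (2 * π * (j - k) * y) ∂μ)
    (S : Finset ι) (c : ι → ℝ) (x : ι → ℤ) :
    ∫ ω, (∑ i ∈ S, c i * f (x i) ω) ^ 2 ∂P =
      ∫ y, ‖∑ i ∈ S, (c i : ℂ) * Complex.exp (2 * π * y * Complex.I) ^ x i‖ ^ 2 ∂μ := by
  have hL (k : ℤ) : MemLp (f k) 2 P := (hf.hasGaussianLaw_eval k).memLp_two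
  have hI (j k : ℤ) : Integrable (fun ω ↦ f j ω * f k ω) P := (hL j).integrable_mul (hL k)
  have hC (j k : ℤ) : Integrable (fun y : ℝ ↦ cos (2 * π * (j - k) * y)) μ :=
    Integrable.of_bound (by fun_prop) 1 (.of_forall fun y ↦ by
      rw [Real.norm_eq_abs]; exact abs_cos_le_one _)
  have e1 (ω : Ω) : (∑ i ∈ S, c i * f (x i) ω) ^ 2 =
      ∑ i ∈ S, ∑ j ∈ S, c i * c j * (f (x i) ω * f (x j) ω) := by
    rw [sq, Finset.sum_mul_sum]
    exact Finset.sum_congr rfl fun i _ ↦ Finset.sum_congr rfl fun j _ ↦ by ring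
  have e2 (y : ℝ) : ‖∑ i ∈ S, (c i : ℂ) * Complex.exp (2 * π * y * Complex.I) ^ x i‖ ^ 2 =
      ∑ i ∈ S, ∑ j ∈ S, c i * c j * cos (2 * π * ((x i : ℤ) - (x j : ℤ)) * y) := by
    have e (i : ι) : Complex.exp (2 * π * y * Complex.I) ^ x i =
        Complex.exp ((2 * π * x i * y : ℝ) * Complex.I) := by
      rw [← Complex.exp_int_mul]
      push_cast
      congr 1; ring
    simp_rw [e]
    rw [norm_sum_mul_exp_sq]
    refine Finset.sum_congr rfl fun i _ ↦ Finset.sum_congr rfl fun j _ ↦ ?_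
    congr 2; ring
  simp_rw [e1, e2]
  rw [integral_finsetSum _ fun i _ ↦ integrable_finsetSum _ fun j _ ↦ (hI _ _).const_mul _,
    integral_finsetSum _ fun i _ ↦ integrable_finsetSum _ fun j _ ↦ (hC _ _).const_mul _]
  refine Finset.sum_congr rfl fun i _ ↦ ?_
  rw [integral_finsetSum _ fun j _ ↦ (hI _ _).const_mul _,
    integral_finsetSum _ fun j _ ↦ (hC _ _).const_mul _]
  refine Finset.sum_congr rfl fun j _ ↦ ?_
  rw [integral_const_mul, integral_const_mul, hcov]

theorem measure_lt_le_exp {Ω : Type*} {_ : MeasurableSpace Ω} {P : Measure Ω} {X : Ω → ℝ}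
    (h : HasGaussianLaw X P) (h0 : ∫ ω, X ω ∂P = 0) {t l : ℝ} (ht : 0 < t) (hl : 0 ≤ l)
    (hX : ∫ ω, X ω ^ 2 ∂P ≤ t ^ 2) :
    P {ω | l * t < X ω} ≤ ENNReal.ofReal (exp (-l ^ 2 / 2)) := by
  have := h.isProbabilityMeasure
  have hm := map_eq_gaussianReal_integral_sq h h0
  have hi : Integrable (fun ω ↦ exp (l / t * X ω)) P := by
    have := integrable_exp_mul_gaussianReal (μ := 0) (v := (∫ ω, X ω ^ 2 ∂P).toNNReal) (l / t)
    rw [← hm] at this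
    exact this.comp_aemeasurable h.aemeasurable
  have key := measure_ge_le_exp_mul_mgf (l * t) (by positivity) hi
  rw [mgf_gaussianReal hm, ← exp_add, Real.coe_toNNReal _ (integral_nonneg fun ω ↦ sq_nonneg _)]
    at key
  refine (measure_mono fun ω (hω : l * t < X ω) ↦ hω.le).trans ?_
  change P {ω | l * t ≤ X ω} ≤ _
  rw [← ofReal_measureReal]
  refine ENNReal.ofReal_le_ofReal (key.trans (exp_le_exp.2 ?_))
  have h1 : (∫ ω, X ω ^ 2 ∂P) * (l / t) ^ 2 ≤ t ^ 2 * (l / t) ^ 2 := by gcongr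
  have h2 : t ^ 2 * (l / t) ^ 2 = l ^ 2 := by field_simp
  have h3 : l / t * (l * t) = l ^ 2 := by field_simp
  linarith

theorem measure_le_two_mul_of_sum_le {Ω ι : Type*} {_ : MeasurableSpace Ω} {P : Measure Ω}
    (I : Finset ι) {b : ι → ℝ} (hb : ∀ i ∈ I, 0 ≤ b i) (hB : 0 < ∑ i ∈ I, b i)
    {S : ι → Set Ω} (hS : ∀ i, NullMeasurableSet (S i) P) {β : ENNReal}
    (hβ : ∀ i ∈ I, P (S i) ≤ β) {E : Set Ω}
    (hE : ∀ ω ∈ E, ∑ i ∈ I, b i ≤ 2 * ∑ i ∈ I, b i * (S i).indicator 1 ω) :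
    P E ≤ 2 * β := by
  set g : Ω → ENNReal := fun ω ↦ ∑ i ∈ I, ENNReal.ofReal (b i) * (S i).indicator 1 ω with hg
  set B : ENNReal := ENNReal.ofReal (∑ i ∈ I, b i) with hBdef
  have hB0 : B ≠ 0 := by simpa [hBdef] using hB
  have hBt : B ≠ ⊤ := ENNReal.ofReal_ne_top
  have hm (i : ι) : AEMeasurable (fun ω ↦ ENNReal.ofReal (b i) * (S i).indicator 1 ω) P :=
    (aemeasurable_const.indicator₀ (hS i)).const_mul _
  have hgm : AEMeasurable (fun ω ↦ 2 * g ω) P :=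
    (Finset.aemeasurable_fun_sum _ fun i _ ↦ hm i).const_mul _
  have h1 := mul_meas_ge_le_lintegral₀ hgm B
  have h2 : ∫⁻ ω, 2 * g ω ∂P ≤ B * (2 * β) := by
    rw [lintegral_const_mul' _ _ (by norm_num), hg, lintegral_finsetSum' _ fun i _ ↦ hm i]
    have : ∑ i ∈ I, ∫⁻ ω, ENNReal.ofReal (b i) * (S i).indicator 1 ω ∂P ≤
        ∑ i ∈ I, ENNReal.ofReal (b i) * β := by
      refine Finset.sum_le_sum fun i hi ↦ ?_
      rw [lintegral_const_mul' _ _ ENNReal.ofReal_ne_top, lintegral_indicator_one₀ (hS i)]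
      gcongr
      exact hβ i hi
    rw [← Finset.sum_mul, ← ENNReal.ofReal_sum_of_nonneg hb] at this
    calc _ ≤ 2 * (B * β) := by gcongr
      _ = _ := by ring
  have h3 : P E ≤ P {ω | B ≤ 2 * g ω} := by
    refine measure_mono fun ω hω ↦ ?_
    have h4 : g ω = ENNReal.ofReal (∑ i ∈ I, b i * (S i).indicator 1 ω) := by
      rw [hg, ENNReal.ofReal_sum_of_nonneg fun i hi ↦
        mul_nonneg (hb i hi) (Set.indicator_nonneg (f := (1 : Ω → ℝ)) (fun _ _ ↦ zero_le_one) _)]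
      refine Finset.sum_congr rfl fun i hi ↦ ?_
      rw [ENNReal.ofReal_mul (hb i hi)]
      by_cases h : ω ∈ S i <;> simp [h]
    change B ≤ 2 * g ω
    rw [h4, ← ENNReal.ofReal_ofNat 2, ← ENNReal.ofReal_mul zero_le_two]
    exact ENNReal.ofReal_le_ofReal (hE ω hω)
  have h5 : B * P E ≤ B * (2 * β) := (mul_le_mul_right h3 _).trans (h1.trans h2)
  exact (ENNReal.mul_le_mul_iff_right hB0 hBt).1 h5

theorem sum_le_two_mul_sum_mul {a g I : ℕ → ℝ} (ha : ∀ k, 0 ≤ a k) (hI : ∀ r, 0 ≤ I r)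
    {s U u n : ℕ} (hn : 0 < n) (hu : u ∈ Finset.range (U + 1)) {τ : ℝ} (hτ : 0 < τ)
    (hg : ∀ k < s * (n + U), 0 ≤ g k)
    (hT : ∀ i < n, ∑ k ∈ Finset.range (s * (U + 1)), a k * g (s * i + k) ≤ τ)
    (hB : 1 / ((U : ℝ) + 1) ≤ ∑ r ∈ Finset.range s, a (s * u + r))
    (hg1 : ∀ r, (∀ i < n, |g (s * i + (s * u + r))| ≤ 2 * n * (U + 1) * τ) → 1 ≤ I r) :
    ∑ r ∈ Finset.range s, a (s * u + r) ≤ 2 * ∑ r ∈ Finset.range s, a (s * u + r) * I r := by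
  have hn' : (0 : ℝ) < n := by exact_mod_cast hn
  set ε : ℝ := 2 * n * (U + 1) * τ with hε
  have hε0 : 0 < ε := by positivity
  have hg0 {i r u : ℕ} (hi : i < n) (hr : r ∈ Finset.range s) (hu : u ∈ Finset.range (U + 1)) :
      0 ≤ g (s * i + (s * u + r)) := by
    have hr := Finset.mem_range.1 hr
    have hu := Finset.mem_range.1 hu
    refine hg _ ?_
    calc s * i + (s * u + r) < s * i + s * u + s := by omega
      _ = s * (i + 1 + u) := by ring
      _ ≤ s * (n + U) := Nat.mul_le_mul_left _ (by omega)
  have h1 : ∑ i ∈ Finset.range n, ∑ r ∈ Finset.range s, a (s * u + r) * g (s * i + (s * u + r)) ≤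
      n * τ := by
    have : ∀ i ∈ Finset.range n,
        ∑ r ∈ Finset.range s, a (s * u + r) * g (s * i + (s * u + r)) ≤ τ := by
      intro i hi
      refine le_trans ?_ (hT i (Finset.mem_range.1 hi))
      rw [sum_range_mul_eq]
      exact Finset.single_le_sum (f := fun u ↦ ∑ r ∈ Finset.range s,
        a (s * u + r) * g (s * i + (s * u + r))) (fun v hv ↦ Finset.sum_nonneg fun r hr ↦
          mul_nonneg (ha _) (hg0 (Finset.mem_range.1 hi) hr hv)) hu
    simpa using Finset.sum_le_sum this
  rw [Finset.sum_comm] at h1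
  have h2 : ∑ r ∈ Finset.range s, a (s * u + r) * (1 - I r) ≤
      ∑ r ∈ Finset.range s, (∑ i ∈ Finset.range n,
        a (s * u + r) * g (s * i + (s * u + r))) / ε := by
    refine Finset.sum_le_sum fun r hr ↦ ?_
    rw [← Finset.mul_sum, mul_div_assoc]
    refine mul_le_mul_of_nonneg_left ?_ (ha _)
    have h3 : ∀ i ∈ Finset.range n, 0 ≤ g (s * i + (s * u + r)) :=
      fun i hi ↦ hg0 (Finset.mem_range.1 hi) hr hu
    by_cases h : ∀ i < n, |g (s * i + (s * u + r))| ≤ ε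
    · have := hg1 r h
      have : 0 ≤ (∑ i ∈ Finset.range n, g (s * i + (s * u + r))) / ε :=
        div_nonneg (Finset.sum_nonneg h3) hε0.le
      linarith
    · push Not at h
      obtain ⟨i, hi, h⟩ := h
      have hi := Finset.mem_range.2 hi
      rw [abs_of_nonneg (h3 i hi)] at h
      have h4 := Finset.single_le_sum (f := fun i ↦ g (s * i + (s * u + r))) h3 hi
      have : 1 ≤ (∑ i ∈ Finset.range n, g (s * i + (s * u + r))) / ε := by
        rw [one_le_div hε0]
        exact h.le.trans h4
      linarith [hI r]
  rw [← Finset.sum_div] at h2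
  have h5 : (∑ r ∈ Finset.range s, ∑ i ∈ Finset.range n,
      a (s * u + r) * g (s * i + (s * u + r))) / ε ≤ 1 / (U + 1) / 2 := by
    rw [div_le_iff₀ hε0]
    refine h1.trans_eq ?_
    rw [hε]; field_simp
  simp only [mul_sub, mul_one, Finset.sum_sub_distrib] at h2
  linarith

/-- The squared `L²(μ)` distance from `e(sny)` to a combination of `e(siy)`, `i < n`. -/
noncomputable def spectralDist (μ : Measure ℝ) (s n : ℕ) (c : ℕ → ℝ) : ℝ :=
  ∫ y : ℝ, ‖(Complex.exp (2 * π * y * Complex.I) ^ s) ^ n -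
    ∑ i ∈ Finset.range n, (c i : ℂ) * (Complex.exp (2 * π * y * Complex.I) ^ s) ^ i‖ ^ 2 ∂μ

theorem norm_exp_two_pi_mul (y : ℝ) : ‖Complex.exp (2 * π * y * Complex.I)‖ = 1 := by
  have := Complex.norm_exp_ofReal_mul_I (2 * π * y)
  push_cast at this
  exact this

theorem integrable_spectralDist (μ : Measure ℝ) [IsFiniteMeasure μ] (s n : ℕ) (c : ℕ → ℝ) :
    Integrable (fun y : ℝ ↦ ‖(Complex.exp (2 * π * y * Complex.I) ^ s) ^ n -
      ∑ i ∈ Finset.range n, (c i : ℂ) * (Complex.exp (2 * π * y * Complex.I) ^ s) ^ i‖ ^ 2) μ := by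
  refine Integrable.of_bound (by fun_prop) ((1 + ∑ i ∈ Finset.range n, |c i|) ^ 2)
    (.of_forall fun y ↦ ?_)
  rw [norm_pow, norm_norm]
  gcongr
  refine (norm_sub_le _ _).trans (add_le_add ?_ ((norm_sum_le _ _).trans
    (Finset.sum_le_sum fun i _ ↦ ?_)))
  · simp [norm_exp_two_pi_mul]
  · simp [norm_exp_two_pi_mul]

theorem integral_sub_sum_mul_sq {Ω : Type*} {_ : MeasurableSpace Ω} {P : Measure Ω}
    {μ : Measure ℝ} [IsFiniteMeasure μ] {f : ℤ → Ω → ℝ} (hf : IsGaussianProcess f P)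
    (hcov : ∀ j k : ℤ, ∫ ω, f j ω * f k ω ∂P = ∫ y, cos (2 * π * (j - k) * y) ∂μ)
    (s m n : ℕ) (c : ℕ → ℝ) :
    ∫ ω, (f ((s * n + m : ℕ)) ω - ∑ i ∈ Finset.range n, c i * f ((s * i + m : ℕ)) ω) ^ 2 ∂P =
      spectralDist μ s n c := by
  have key := integral_sq_sum_eq hf hcov (Finset.range (n + 1))
    (fun i ↦ if i = n then 1 else -c i) (fun i ↦ ((s * i + m : ℕ) : ℤ))
  have h : ∀ i ∈ Finset.range n, i ≠ n := fun i hi ↦ (Finset.mem_range.1 hi).ne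
  convert key using 1
  · congr 1
    ext ω
    have e : ∑ i ∈ Finset.range n, (if i = n then 1 else -c i) * f ((s * i + m : ℕ)) ω =
        -∑ i ∈ Finset.range n, c i * f ((s * i + m : ℕ)) ω := by
      rw [← Finset.sum_neg_distrib]
      exact Finset.sum_congr rfl fun i hi ↦ by rw [if_neg (h i hi), neg_mul]
    rw [Finset.sum_range_succ, if_pos rfl, e]
    ring
  · rw [spectralDist]
    congr 1
    ext y
    set z := Complex.exp (2 * π * y * Complex.I) with hz
    have e : ∑ i ∈ Finset.range (n + 1), ((if i = n then 1 else -c i : ℝ) : ℂ) *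
        z ^ ((s * i + m : ℕ) : ℤ) =
        z ^ m * ((z ^ s) ^ n - ∑ i ∈ Finset.range n, (c i : ℂ) * (z ^ s) ^ i) := by
      rw [Finset.sum_range_succ, if_pos rfl, Finset.sum_congr rfl fun i hi ↦ by
        rw [if_neg (h i hi)], mul_sub, Finset.mul_sum, sub_eq_neg_add, ← Finset.sum_neg_distrib]
      congr 1
      · refine Finset.sum_congr rfl fun i _ ↦ ?_
        rw [zpow_natCast, pow_add, pow_mul]; push_cast; ring
      · rw [zpow_natCast, pow_add, pow_mul]; push_cast; ring
    rw [e, norm_mul, norm_pow, norm_exp_two_pi_mul, one_pow, one_mul]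

theorem measure_forall_nonneg_le {Ω : Type*} {_ : MeasurableSpace Ω} {P : Measure Ω}
    {μ : Measure ℝ} [IsFiniteMeasure μ] {f : ℤ → Ω → ℝ} (hf : IsGaussianProcess f P)
    (h0 : ∀ t, ∫ ω, f t ω ∂P = 0)
    (hcov : ∀ j k : ℤ, ∫ ω, f j ω * f k ω ∂P = ∫ y, cos (2 * π * (j - k) * y) ∂μ)
    {δ : ℝ} (hδ : 0 < δ) (hμ : ∀ᵐ y ∂μ, δ < |y| ∧ |y| ≤ 1 / 2) {s M : ℕ} (hs : 1 ≤ δ * s)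
    (hM : 0 < M) {n N : ℕ} (hN : 0 < N) {c : ℕ → ℝ} {ρ σ l : ℝ} (hρ : 0 < ρ)
    (hc : spectralDist μ s n c ≤ ρ ^ 2) (hσ : 0 < σ)
    (hσ' : ∀ k < N, ∀ c, σ ^ 2 ≤ spectralDist μ s k c) (hl : 0 < l) {L : ℕ}
    (hL : s * (N + n * (2 * (1 + M))) ≤ L) :
    P {ω | ∀ k : ℕ, k ≤ L → 0 ≤ f k ω} ≤ N * ENNReal.ofReal (exp (-l ^ 2 / 2)) +
      2 * ENNReal.ofReal (2 * (2 * N * ((n * (2 * (1 + M)) : ℕ) + 1) *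
        (l * ((1 / (M : ℝ) ^ 2) ^ n * ρ))) / σ) ^ N := by
  have hM' : (0 : ℝ) < M := by exact_mod_cast hM
  obtain ⟨a, ha, ha1, haz⟩ := exists_weights_norm_le hδ hs hM n c
  set U := n * (2 * (1 + M)) with hU
  set t : ℝ := (1 / (M : ℝ) ^ 2) ^ n * ρ with ht
  have ht0 : 0 < t := by positivity
  obtain ⟨u, hu, hB⟩ : ∃ u ∈ Finset.range (U + 1),
      1 / ((U : ℝ) + 1) ≤ ∑ r ∈ Finset.range s, a (s * u + r) := by
    refine Finset.exists_le_of_sum_le (by simp) ?_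
    rw [← sum_range_mul_eq, ha1]
    simp
    field_simp
    rfl
  set T : ℕ → Ω → ℝ := fun i ω ↦
    ∑ k ∈ Finset.range (s * (U + 1)), a k * f ((s * i + k : ℕ)) ω with hT
  have hTG (i : ℕ) : HasGaussianLaw (T i) P :=
    hasGaussianLaw_sum_mul (Y := fun k ↦ f ((s * i + k : ℕ)))
      (hf.comp_right fun k : ℕ ↦ ((s * i + k : ℕ) : ℤ)) a _
  have hT0 (i : ℕ) : ∫ ω, T i ω ∂P = 0 := by
    rw [hT, integral_finsetSum _ fun k _ ↦
      (hf.hasGaussianLaw_eval _).integrable.const_mul _]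
    simp [integral_const_mul, h0]
  have hTv (i : ℕ) : ∫ ω, T i ω ^ 2 ∂P ≤ t ^ 2 := by
    rw [integral_sq_sum_eq hf hcov]
    have h1 : ∫ y : ℝ, ((1 / (M : ℝ) ^ 2) ^ n) ^ 2 *
        ‖(Complex.exp (2 * π * y * Complex.I) ^ s) ^ n - ∑ i ∈ Finset.range n,
          (c i : ℂ) * (Complex.exp (2 * π * y * Complex.I) ^ s) ^ i‖ ^ 2 ∂μ ≤ t ^ 2 := by
      rw [integral_const_mul, ht, mul_pow]
      exact mul_le_mul_of_nonneg_left hc (by positivity)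
    refine le_trans (integral_mono_of_nonneg (.of_forall fun y ↦ sq_nonneg _)
      ((integrable_spectralDist μ s n c).const_mul _) ?_) h1
    filter_upwards [hμ] with y hy
    have h2 := haz _ (norm_exp_two_pi_mul y) (four_mul_le_norm_exp_sub_one hy.1 hy.2)
    have h3 : ∑ k ∈ Finset.range (s * (U + 1)), (a k : ℂ) *
        Complex.exp (2 * π * y * Complex.I) ^ ((s * i + k : ℕ) : ℤ) =
        Complex.exp (2 * π * y * Complex.I) ^ (s * i) * ∑ k ∈ Finset.range (s * (U + 1)),
          (a k : ℂ) * Complex.exp (2 * π * y * Complex.I) ^ k := by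
      rw [Finset.mul_sum]
      refine Finset.sum_congr rfl fun k _ ↦ ?_
      rw [zpow_natCast, pow_add]; ring
    rw [h3, norm_mul, norm_pow, norm_exp_two_pi_mul, one_pow, one_mul, ← mul_pow]
    gcongr
  set ε : ℝ := 2 * N * ((U : ℕ) + 1) * (l * t) with hε
  set S : ℕ → Set Ω := fun r ↦ {ω | ∀ i < N, |f ((s * i + (s * u + r) : ℕ)) ω| ≤ ε} with hS
  have hSm (r : ℕ) : NullMeasurableSet (S r) P := by
    have : S r = ⋂ i, ⋂ (_ : i < N), {ω | |f ((s * i + (s * u + r) : ℕ)) ω| ≤ ε} := by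
      ext ω; simp [hS]
    rw [this]
    refine .iInter fun i ↦ .iInter fun _ ↦ nullMeasurableSet_le ?_ aemeasurable_const
    exact continuous_abs.measurable.comp_aemeasurable (hf.aemeasurable _)
  have hSP (r : ℕ) : P (S r) ≤ ENNReal.ofReal (2 * ε / σ) ^ N := by
    refine measure_forall_abs_le_le (Y := fun i ↦ f ((s * i + (s * u + r) : ℕ)))
      (hf.comp_right fun i : ℕ ↦ ((s * i + (s * u + r) : ℕ) : ℤ)) (fun i ↦ h0 _) hσ (by positivity)
      N fun k hk b ↦ ?_
    rw [integral_sub_sum_mul_sq hf hcov]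
    exact hσ' k hk b
  set E := {ω | (∀ k : ℕ, k ≤ L → 0 ≤ f k ω) ∧ ∀ i < N, T i ω ≤ l * t} with hE
  have h1 : P E ≤ 2 * ENNReal.ofReal (2 * ε / σ) ^ N := by
    refine measure_le_two_mul_of_sum_le (Finset.range s) (b := fun r ↦ a (s * u + r))
      (fun r _ ↦ ha _) (lt_of_lt_of_le (by positivity) hB) hSm (fun r _ ↦ hSP r) ?_
    rintro ω ⟨hω, hω'⟩
    refine sum_le_two_mul_sum_mul (g := fun k ↦ f k ω) (I := fun r ↦ (S r).indicator 1 ω) ha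
      (fun r ↦ Set.indicator_nonneg (f := (1 : Ω → ℝ)) (fun _ _ ↦ zero_le_one) _) hN hu
      (mul_pos hl ht0) (fun k hk ↦ hω k (hk.le.trans hL)) hω' hB fun r hr ↦ ?_
    rw [Set.indicator_of_mem (show ω ∈ S r from hr)]
    rfl
  calc P {ω | ∀ k : ℕ, k ≤ L → 0 ≤ f k ω}
      ≤ P ((⋃ i ∈ Finset.range N, {ω | l * t < T i ω}) ∪ E) := by
        refine measure_mono fun ω hω ↦ ?_
        by_cases h : ∀ i < N, T i ω ≤ l * t
        · exact .inr ⟨hω, h⟩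
        · push Not at h
          obtain ⟨i, hi, h⟩ := h
          exact .inl (Set.mem_biUnion (Finset.mem_range.2 hi) h)
    _ ≤ P (⋃ i ∈ Finset.range N, {ω | l * t < T i ω}) + P E := measure_union_le _ _
    _ ≤ _ := by
        refine add_le_add ((measure_biUnion_finset_le _ _).trans ?_) h1
        refine (Finset.sum_le_sum fun i _ ↦
          measure_lt_le_exp (hTG i) (hT0 i) ht0 hl.le (hTv i)).trans_eq ?_
        simp

theorem spectralDist_nonneg (μ : Measure ℝ) (s n : ℕ) (c : ℕ → ℝ) : 0 ≤ spectralDist μ s n c :=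
  integral_nonneg fun _ ↦ sq_nonneg _

theorem spectralDist_zero (μ : Measure ℝ) (s : ℕ) (c : ℕ → ℝ) :
    spectralDist μ s 0 c = μ.real Set.univ := by
  simp [spectralDist]

theorem bddBelow_spectralDist (μ : Measure ℝ) (s n : ℕ) :
    BddBelow (Set.range (spectralDist μ s n)) :=
  ⟨0, by rintro _ ⟨c, rfl⟩; exact spectralDist_nonneg μ s n c⟩

theorem antitone_iInf_spectralDist (μ : Measure ℝ) (s : ℕ) :
    Antitone fun n ↦ ⨅ c, spectralDist μ s n c := by
  refine antitone_nat_of_succ_le fun n ↦ le_ciInf fun c ↦ ?_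
  refine (ciInf_le (bddBelow_spectralDist μ s (n + 1)) fun i ↦ i.casesOn 0 c).trans_eq ?_
  rw [spectralDist, spectralDist]
  congr 1
  ext y
  rw [Finset.sum_range_succ']
  set z := Complex.exp (2 * π * y * Complex.I) with hz
  have e : (z ^ s) ^ (n + 1) - (∑ k ∈ Finset.range n, (c k : ℂ) * (z ^ s) ^ (k + 1) +
      ((0 : ℝ) : ℂ) * (z ^ s) ^ 0) =
      z ^ s * ((z ^ s) ^ n - ∑ i ∈ Finset.range n, (c i : ℂ) * (z ^ s) ^ i) := by
    rw [mul_sub, Finset.mul_sum, Complex.ofReal_zero, zero_mul, add_zero]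
    congr 1
    · ring
    · exact Finset.sum_congr rfl fun i _ ↦ by ring
  change ‖(z ^ s) ^ (n + 1) - (∑ k ∈ Finset.range n, (c k : ℂ) * (z ^ s) ^ (k + 1) +
      ((0 : ℝ) : ℂ) * (z ^ s) ^ 0)‖ ^ 2 = _
  rw [e, norm_mul, norm_pow, norm_exp_two_pi_mul, one_pow, one_mul]

theorem exists_spectralDist_le {μ : Measure ℝ} (hμ : 0 < μ.real Set.univ) (s : ℕ) {n : ℕ}
    (hn : 0 < n) {κ : ℝ} (hκ : 0 < κ) :
    ∃ (N : ℕ) (c : ℕ → ℝ) (ρ σ : ℝ), 0 < N ∧ N ≤ n ∧ 0 < ρ ∧ 0 < σ ∧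
      spectralDist μ s n c ≤ ρ ^ 2 ∧ (∀ k < N, ∀ c, σ ^ 2 ≤ spectralDist μ s k c) ∧
      ((N = n ∧ ρ = 2 * σ) ∨ (N = 1 ∧ ρ = κ * σ)) := by
  rcases (Real.iInf_nonneg (spectralDist_nonneg μ s n)).eq_or_lt' with h | h
  · obtain ⟨c, hc⟩ := exists_lt_of_ciInf_lt
      (h.trans_lt (show 0 < (κ * √(μ.real Set.univ)) ^ 2 by positivity))
    refine ⟨1, c, _, √(μ.real Set.univ), one_pos, hn, by positivity, by positivity, hc.le,
      fun k hk c ↦ ?_, .inr ⟨rfl, rfl⟩⟩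
    obtain rfl : k = 0 := by omega
    rw [sq_sqrt hμ.le, spectralDist_zero]
  · set V := ⨅ c, spectralDist μ s n c with hV
    obtain ⟨c, hc⟩ := exists_lt_of_ciInf_lt (show V < (2 * √V) ^ 2 by
      rw [mul_pow, sq_sqrt h.le]; linarith)
    refine ⟨n, c, _, √V, hn, le_rfl, by positivity, by positivity, hc.le, fun k hk c ↦ ?_,
      .inl ⟨rfl, rfl⟩⟩
    rw [sq_sqrt h.le]
    exact (antitone_iInf_spectralDist μ s hk.le).trans (ciInf_le (bddBelow_spectralDist μ s k) c)

theorem mul_inv_pow_le_exp_neg {n : ℕ} (hn : 0 < n) :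
    8 * n * ((n * (2 * (1 + 4096)) : ℕ) + 1) * (2 * n) * (1 / ((4096 : ℕ) : ℝ) ^ 2) ^ n ≤
      exp (-(2 * n)) := by
  have hn1 : (1 : ℝ) ≤ n := by exact_mod_cast hn
  have h2 : (n : ℝ) ≤ 2 ^ n := by exact_mod_cast Nat.lt_two_pow_self.le
  have he : exp (2 * n) ≤ 8 ^ n := by
    rw [mul_comm, exp_nat_mul]
    gcongr
    have h3 : exp 2 = exp 1 ^ 2 := by rw [← exp_nat_mul]; norm_num
    rw [h3]
    nlinarith [exp_one_lt_d9, exp_pos 1]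
  rw [exp_neg, div_pow, one_pow, mul_one_div, div_le_iff₀ (by positivity), ← div_eq_inv_mul,
    le_div_iff₀ (exp_pos _)]
  have e : ((n * (2 * (1 + 4096)) : ℕ) : ℝ) = n * 8194 := by push_cast; ring
  rw [e]
  have h4 : 8 * (n : ℝ) * (n * 8194 + 1) * (2 * n) ≤ 131120 * n ^ 3 := by
    nlinarith [sq_nonneg (n : ℝ)]
  have h5 : (n : ℝ) ^ 3 ≤ 8 ^ n := by
    calc (n : ℝ) ^ 3 ≤ (2 ^ n) ^ 3 := by gcongr
      _ = 8 ^ n := by rw [← pow_mul, mul_comm, pow_mul]; norm_num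
  have h6 : (131120 : ℝ) ≤ 262144 ^ n :=
    le_trans (by norm_num) (le_self_pow₀ (by norm_num : (1 : ℝ) ≤ 262144) hn.ne')
  calc _ ≤ 131120 * (n : ℝ) ^ 3 * 8 ^ n := by gcongr
    _ ≤ 262144 ^ n * 8 ^ n * 8 ^ n := by gcongr
    _ = _ := by rw [← mul_pow, ← mul_pow]; norm_num

theorem measure_nonneg_le_half {Ω : Type*} {_ : MeasurableSpace Ω} {P : Measure Ω} {X : Ω → ℝ}
    (h : HasGaussianLaw X P) (h0 : ∫ ω, X ω ∂P = 0) (hX : 0 < ∫ ω, X ω ^ 2 ∂P) :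
    P {ω | 0 ≤ X ω} ≤ ENNReal.ofReal (1 / 2) := by
  have hm := map_eq_gaussianReal_integral_sq h h0
  set v := (∫ ω, X ω ^ 2 ∂P).toNNReal with hv
  have hv0 : v ≠ 0 := by simpa [hv] using hX
  have := nullSingletonClass_gaussianReal (μ := 0) hv0
  have e1 : P {ω | 0 ≤ X ω} = gaussianReal 0 v (Set.Ici 0) := by
    rw [← hm, Measure.map_apply_of_aemeasurable h.aemeasurable measurableSet_Ici]; rfl
  have e2 : gaussianReal 0 v (Set.Iic 0) = gaussianReal 0 v (Set.Ici 0) := by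
    have := gaussianReal_map_neg (μ := 0) (v := v)
    rw [neg_zero] at this
    conv_lhs => rw [← this]
    rw [Measure.map_apply (by fun_prop) measurableSet_Iic]
    congr 1
    ext x; simp
  have e3 := measure_add_measure_compl (μ := gaussianReal 0 v) (measurableSet_Ici (a := (0 : ℝ)))
  rw [Set.compl_Ici, measure_univ, ← measure_congr (Iio_ae_eq_Iic (a := (0 : ℝ))).symm, e2,
    ← two_mul] at e3
  have e4 := (ENNReal.eq_div_iff two_ne_zero ENNReal.ofNat_ne_top).2 e3
  rw [e1, e4, ENNReal.ofReal_div_of_pos two_pos, ENNReal.ofReal_one, ENNReal.ofReal_ofNat]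

theorem add_two_mul_exp_le {n : ℕ} (hn : 0 < n) :
    (n + 2) * exp (-(2 * (n : ℝ) ^ 2)) ≤ exp (-((n : ℝ) ^ 2 / 2)) := by
  have hn1 : (1 : ℝ) ≤ n := by exact_mod_cast hn
  have h : (n : ℝ) + 2 ≤ exp (3 / 2 * (n : ℝ) ^ 2) := by
    refine le_trans ?_ (quadratic_le_exp_of_nonneg (by positivity))
    nlinarith [sq_nonneg ((n : ℝ) ^ 2 - 1)]
  calc _ ≤ exp (3 / 2 * (n : ℝ) ^ 2) * exp (-(2 * (n : ℝ) ^ 2)) := by gcongr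
    _ = _ := by rw [← exp_add]; congr 1; ring

theorem measure_forall_nonneg_le_exp {Ω : Type*} {_ : MeasurableSpace Ω} {P : Measure Ω}
    {μ : Measure ℝ} [IsFiniteMeasure μ] {f : ℤ → Ω → ℝ} (hf : IsGaussianProcess f P)
    (h0 : ∀ t, ∫ ω, f t ω ∂P = 0)
    (hcov : ∀ j k : ℤ, ∫ ω, f j ω * f k ω ∂P = ∫ y, cos (2 * π * (j - k) * y) ∂μ)
    (hμ0 : 0 < μ.real Set.univ) {δ : ℝ} (hδ : 0 < δ)
    (hμ : ∀ᵐ y ∂μ, δ < |y| ∧ |y| ≤ 1 / 2) {s : ℕ} (hs : 1 ≤ δ * s) {n L : ℕ} (hn : 0 < n)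
    (hL : s * (8195 * n) ≤ L) :
    P {ω | ∀ k : ℕ, k ≤ L → 0 ≤ f k ω} ≤ ENNReal.ofReal (exp (-((n : ℝ) ^ 2 / 2))) := by
  have hn1 : (1 : ℝ) ≤ n := by exact_mod_cast hn
  obtain ⟨N, c, ρ, σ, hN, hNn, hρ, hσ, hc, hσ', hcase⟩ :=
    exists_spectralDist_le hμ0 s hn (exp_pos (-(2 * (n : ℝ) ^ 2)))
  have key := measure_forall_nonneg_le hf h0 hcov hδ hμ hs (M := 4096) (by norm_num) hN hρ hc hσ
    hσ' (l := 2 * n) (by positivity) (L := L)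
    (le_trans (Nat.mul_le_mul_left _ (by omega)) hL)
  refine key.trans (le_trans ?_ (ENNReal.ofReal_le_ofReal (add_two_mul_exp_le hn)))
  have hnum := mul_inv_pow_le_exp_neg hn
  set U : ℝ := ((n * (2 * (1 + 4096)) : ℕ) : ℝ) + 1 with hU
  have hU0 : 0 < U := by positivity
  set η : ℝ := (1 / ((4096 : ℕ) : ℝ) ^ 2) ^ n with hη
  have hη0 : 0 < η := by positivity
  have h1 : ENNReal.ofReal (2 * (2 * N * U * (2 * n * (η * ρ))) / σ) ^ N ≤
      ENNReal.ofReal (exp (-(2 * (n : ℝ) ^ 2))) := by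
    rcases hcase with ⟨rfl, rfl⟩ | ⟨rfl, rfl⟩
    · have e : 2 * (2 * N * U * (2 * N * (η * (2 * σ)))) / σ = 8 * N * U * (2 * N) * η := by
        field_simp; ring
      rw [e, ← ENNReal.ofReal_pow (by positivity)]
      refine ENNReal.ofReal_le_ofReal ((pow_le_pow_left₀ (by positivity) hnum N).trans_eq ?_)
      rw [← exp_nat_mul]
      congr 1; ring
    · have e : 2 * (2 * (1 : ℕ) * U * (2 * n * (η * (exp (-(2 * (n : ℝ) ^ 2)) * σ)))) / σ =
          4 * 1 * U * (2 * n) * η * exp (-(2 * (n : ℝ) ^ 2)) := by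
        push_cast; field_simp; ring
      rw [e, pow_one]
      refine ENNReal.ofReal_le_ofReal (mul_le_of_le_one_left (exp_pos _).le ?_)
      calc 4 * 1 * U * (2 * n) * η ≤ 8 * n * U * (2 * n) * η := by gcongr; norm_num
        _ ≤ 1 := hnum.trans (exp_le_one_iff.2 (by linarith))
  have h2 : -(2 * (n : ℝ)) ^ 2 / 2 = -(2 * (n : ℝ) ^ 2) := by ring
  rw [h2]
  calc _ ≤ (n : ENNReal) * ENNReal.ofReal (exp (-(2 * (n : ℝ) ^ 2))) +
        2 * ENNReal.ofReal (exp (-(2 * (n : ℝ) ^ 2))) := by gcongr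
    _ = _ := by
      rw [← add_mul, ENNReal.ofReal_mul (by positivity),
        ENNReal.ofReal_add (by positivity) zero_le_two]
      simp

/-- There exists an absolute constant `c > 0` such that for every centered
stationary Gaussian process `f` on `ℤ` whose spectral measure `μ` is a finite nonzero symmetric
measure supported on `[-1/2, 1/2]` with `μ([-δ, δ]) = 0` for some `δ ∈ (0, 1/2)`, and every
integer `L ≥ 0`, the probability that `f(0), f(1), …, f(L)` are all nonnegative is at most
`exp (-c * δ² * L²)`. -/
theorem positivity_probability_spectral_gap_discrete :
    ∃ c : ℝ, 0 < c ∧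
      ∀ (Ω : Type) (_ : MeasurableSpace Ω) (P : Measure Ω), IsProbabilityMeasure P →
      ∀ (μ : Measure ℝ), IsFiniteMeasure μ → μ ≠ 0 →
      (∀ E : Set ℝ, MeasurableSet E → μ ((fun x : ℝ => -x) ⁻¹' E) = μ E) →
      μ (Set.Icc (-(1/2 : ℝ)) (1/2))ᶜ = 0 →
      ∀ (f : ℤ → Ω → ℝ),
      (∀ (m : ℕ) (x : Fin m → ℤ) (a : Fin m → ℝ), ∃ v : ℝ≥0,
        P.map (fun ω => ∑ i, a i * f (x i) ω) = gaussianReal 0 v) →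
      (∀ j k : ℤ, ∫ ω, f j ω * f k ω ∂P = ∫ y, Real.cos (2 * π * (j - k) * y) ∂μ) →
      ∀ δ : ℝ, 0 < δ → δ < 1/2 → μ (Set.Icc (-δ) δ) = 0 →
      ∀ L : ℕ,
        P {ω | ∀ k : ℕ, k ≤ L → 0 ≤ f k ω} ≤
          ENNReal.ofReal (Real.exp (-c * δ ^ 2 * (L : ℝ) ^ 2)) := by
  refine ⟨1 / (32 * 8195 ^ 2), by positivity, ?_⟩
  intro Ω _ P _ μ _ hμ _ hsupp f hf hcov δ hδ hδ2 hgap L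
  have hG := isGaussianProcess_of_forall_map_sum hf
  have h0 := integral_eq_zero_of_forall_map_sum hf
  have hμ0 : 0 < μ.real Set.univ := by
    rw [measureReal_def]
    exact ENNReal.toReal_pos (by simpa using hμ) (measure_ne_top _ _)
  have hae : ∀ᵐ y ∂μ, δ < |y| ∧ |y| ≤ 1 / 2 := by
    have h1 : ∀ᵐ y ∂μ, y ∈ Set.Icc (-(1 / 2 : ℝ)) (1 / 2) := mem_ae_iff.2 hsupp
    filter_upwards [h1, measure_eq_zero_iff_ae_notMem.1 hgap] with y hy hy'
    exact ⟨lt_of_not_ge fun h ↦ hy' (abs_le.1 h), abs_le.2 hy⟩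
  set s := ⌈1 / δ⌉₊ with hs
  have hs1 : 1 ≤ δ * s := by
    have := mul_le_mul_of_nonneg_left (Nat.le_ceil (1 / δ)) hδ.le
    rwa [mul_one_div_cancel hδ.ne'] at this
  have hs2 : δ * s ≤ 2 := by
    have := mul_le_mul_of_nonneg_left (Nat.ceil_lt_add_one (one_div_pos.2 hδ).le).le hδ.le
    rw [mul_add, mul_one_div_cancel hδ.ne'] at this
    linarith
  have hs0 : 0 < s := Nat.pos_of_ne_zero fun h ↦ by norm_num [h] at hs1
  set n := L / (s * 8195) with hn
  have hnL : n * (s * 8195) ≤ L := Nat.div_mul_le_self _ _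
  have hLn : δ * L ≤ 2 * 8195 * (n + 1) := by
    have h1 : (L : ℝ) ≤ s * 8195 * (n + 1) := by
      exact_mod_cast (Nat.lt_mul_div_succ L (show 0 < s * 8195 by positivity)).le
    calc δ * L ≤ δ * (s * 8195 * (n + 1)) := by gcongr
      _ = δ * s * (8195 * (n + 1)) := by ring
      _ ≤ 2 * (8195 * (n + 1)) := by gcongr
      _ = _ := by ring
  have hsq : (δ * L) ^ 2 ≤ (2 * 8195 * (n + 1)) ^ 2 := by gcongr
  rcases Nat.eq_zero_or_pos n with h | h
  · have h1 : P {ω | 0 ≤ f 0 ω} ≤ ENNReal.ofReal (1 / 2) := by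
      refine measure_nonneg_le_half (hG.hasGaussianLaw_eval 0) (h0 0) ?_
      have := hcov 0 0
      simp only [← sq, sub_self, mul_zero, zero_mul, cos_zero, integral_const, smul_eq_mul,
        mul_one] at this
      rwa [this]
    refine (measure_mono fun ω hω ↦ by simpa using hω 0 (Nat.zero_le _)).trans
      (h1.trans (ENNReal.ofReal_le_ofReal ?_))
    refine le_trans ?_ (add_one_le_exp _)
    rw [h] at hsq
    norm_num at hsq ⊢
    nlinarith
  · refine (measure_forall_nonneg_le_exp hG h0 hcov hμ0 hδ hae hs1 h
      (by linarith)).trans (ENNReal.ofReal_le_ofReal (exp_le_exp.2 ?_))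
    have h1 : (1 : ℝ) ≤ n := by exact_mod_cast h
    have h2 : (2 * 8195 * ((n : ℝ) + 1)) ^ 2 ≤ (2 * 8195 * (2 * n)) ^ 2 := by
      gcongr; linarith
    nlinarith
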